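/- Let p₁(·), p₂(·) : ℝⁿ → [1,∞) satisfy 1 < (pⱼ)₋ ≤ (pⱼ)₊ < ∞ and pⱼ(·) ∈ LH for j = 1,2, define p(·) by 1/p = 1/p₁ + 1/p₂, let w₁, w₂ be weights with w = w₁w₂ and (w₁,w₂,w) ∈ A_{p⃗(·)}, and set σₗ(x) = wₗ(x)^{−pₗ'(x)} for l = 1,2. For a cube Q, let q(Q) be defined by 1/q(Q) = 1/(p₁)₋(Q) + 1/(p₂)₋(Q). Then for l = 1,2 there is a constant C independent of Q such that (σₗ(Q)/‖wₗ^{−1}χ_Q‖_{pₗ'(·)})^{q(Q)} ≤ C·σₗ(Q)^{q(Q)/(pₗ)₋(Q)} for every cube Q. -/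

import Mathlib

open MeasureTheory ENNReal Set

noncomputable section

/-- Euclidean space `ℝⁿ`. -/
abbrev Rn (n : ℕ) : Type := Fin n → ℝ

/-- A cube in `ℝⁿ` with sides parallel to the coordinate axes. -/
structure Cube (n : ℕ) : Type where
  base : Fin n → ℝ
  side : ℝ
  side_pos : 0 < side

namespace Cube

/-- The set of points of a cube. -/
def toSet {n : ℕ} (Q : Cube n) : Set (Rn n) :=
  {x | ∀ i, Q.base i ≤ x i ∧ x i < Q.base i + Q.side}

/-- The volume `|Q|` of a cube. -/
def vol {n : ℕ} (Q : Cube n) : ℝ≥0∞ := ENNReal.ofReal (Q.side ^ n)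

/-- Membership in the standard dyadic grid `𝒟₀`. -/
def IsDyadic {n : ℕ} (Q : Cube n) : Prop :=
  ∃ (k : ℤ) (j : Fin n → ℤ), Q.side = (2 : ℝ) ^ (-k) ∧
    ∀ i, Q.base i = (2 : ℝ) ^ (-k) * (j i : ℝ)

end Cube

/-- The modular associated to an extended-real-valued exponent `r(·)`:
`ρ(f/λ) = ∫_{r ≠ ∞} (f/λ)^{r(x)} dμ + ‖f/λ‖_{L^∞({r = ∞})}`. -/
def eModular {n : ℕ} (r : Rn n → ℝ≥0∞) (μ : Measure (Rn n)) (f : Rn n → ℝ≥0∞)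
    (lam : ℝ≥0∞) : ℝ≥0∞ :=
  (∫⁻ x in {x | r x ≠ ∞}, (f x / lam) ^ (r x).toReal ∂μ)
    + essSup (fun x => f x / lam) (μ.restrict {x | r x = ∞})

/-- The variable Lebesgue (quasi)norm `‖f‖_{r(·)}` with respect to a measure `μ`. -/
def eNorm {n : ℕ} (r : Rn n → ℝ≥0∞) (μ : Measure (Rn n)) (f : Rn n → ℝ≥0∞) : ℝ≥0∞ :=
  sInf {lam : ℝ≥0∞ | lam ≠ 0 ∧ eModular r μ f lam ≤ 1}

/-- The variable Lebesgue norm of a real-valued function with respect to Lebesgue measure. -/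
def vNorm {n : ℕ} (r : Rn n → ℝ≥0∞) (f : Rn n → ℝ) : ℝ≥0∞ :=
  eNorm r volume fun x => ENNReal.ofReal |f x|

/-- View a real-valued exponent as an extended-real-valued one. -/
def ofExp {n : ℕ} (p : Rn n → ℝ) : Rn n → ℝ≥0∞ := fun x => ENNReal.ofReal (p x)

/-- The conjugate of an extended real exponent: `1/t + 1/t' = 1`. -/
def econj (t : ℝ≥0∞) : ℝ≥0∞ :=
  if t = 1 then ∞ else if t = ∞ then 1 else ENNReal.ofReal (t.toReal / (t.toReal - 1))

/-- The pointwise conjugate exponent `p'(·)` of a real-valued exponent. -/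
def conjExp {n : ℕ} (p : Rn n → ℝ) : Rn n → ℝ≥0∞ := fun x => econj (ENNReal.ofReal (p x))

/-- A weight: a measurable function that is positive (and finite) a.e. -/
def IsWeight {n : ℕ} (w : Rn n → ℝ) : Prop :=
  Measurable w ∧ ∀ᵐ x ∂(volume : Measure (Rn n)), 0 < w x

/-- Local log-Hölder continuity `LH₀`. -/
def LH0 {n : ℕ} (p : Rn n → ℝ) : Prop :=
  ∃ C₀ > 0, ∀ x y : Rn n, dist x y < 1 / 2 →
    |1 / p x - 1 / p y| ≤ C₀ / (-Real.log (dist x y))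

/-- Log-Hölder continuity at infinity with a given asymptotic value `pinf`. -/
def LHinfWith {n : ℕ} (p : Rn n → ℝ) (pinf : ℝ) : Prop :=
  ∃ C > 0, ∀ x : Rn n, |1 / p x - 1 / pinf| ≤ C / Real.log (Real.exp 1 + ‖x‖)

/-- Log-Hölder continuity at infinity `LH∞`. -/
def LHinf {n : ℕ} (p : Rn n → ℝ) : Prop := ∃ pinf > 0, LHinfWith p pinf

/-- Log-Hölder continuity `LH = LH₀ ∩ LH∞`. -/
def LH {n : ℕ} (p : Rn n → ℝ) : Prop := LH0 p ∧ LHinf p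

/-- The bilinear variable Muckenhoupt condition `(w₁,w₂,w) ∈ A_{p⃗(·)}`. -/
def ApVec {n : ℕ} (p₁ p₂ p w₁ w₂ w : Rn n → ℝ) : Prop :=
  ∃ C : ℝ≥0∞, C ≠ ∞ ∧ ∀ Q : Cube n,
    Q.vol⁻¹ ^ 2 * vNorm (ofExp p) (Q.toSet.indicator w) *
      vNorm (conjExp p₁) (Q.toSet.indicator fun x => (w₁ x)⁻¹) *
      vNorm (conjExp p₂) (Q.toSet.indicator fun x => (w₂ x)⁻¹) ≤ C

/-- The variable Muckenhoupt class `A_{r(·)}` for an extended-real-valued exponent. -/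
def ApVarE {n : ℕ} (r : Rn n → ℝ≥0∞) (v : Rn n → ℝ) : Prop :=
  ∃ C : ℝ≥0∞, C ≠ ∞ ∧ ∀ Q : Cube n,
    Q.vol⁻¹ * vNorm r (Q.toSet.indicator v) *
      vNorm (fun x => econj (r x)) (Q.toSet.indicator fun x => (v x)⁻¹) ≤ C

/-- The bilinear maximal operator `M(f₁,f₂)`. -/
def biMax {n : ℕ} (f₁ f₂ : Rn n → ℝ) (x : Rn n) : ℝ≥0∞ :=
  ⨆ (Q : Cube n) (_ : x ∈ Q.toSet),
    (Q.vol⁻¹ * ∫⁻ y in Q.toSet, ENNReal.ofReal |f₁ y|) *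
      (Q.vol⁻¹ * ∫⁻ y in Q.toSet, ENNReal.ofReal |f₂ y|)

/-- The dyadic bilinear maximal operator `M^d(f₁,f₂)`. -/
def biMaxD {n : ℕ} (f₁ f₂ : Rn n → ℝ) (x : Rn n) : ℝ≥0∞ :=
  ⨆ (Q : Cube n) (_ : Q.IsDyadic) (_ : x ∈ Q.toSet),
    (Q.vol⁻¹ * ∫⁻ y in Q.toSet, ENNReal.ofReal |f₁ y|) *
      (Q.vol⁻¹ * ∫⁻ y in Q.toSet, ENNReal.ofReal |f₂ y|)

/-- The bilinear averaging operator `A_Q(f₁,f₂) = (⨍_Q f₁)(⨍_Q f₂)χ_Q`. -/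
def avgOp {n : ℕ} (Q : Cube n) (f₁ f₂ : Rn n → ℝ) (x : Rn n) : ℝ≥0∞ :=
  Q.toSet.indicator
    (fun _ =>
      (Q.vol⁻¹ * ∫⁻ y in Q.toSet, ENNReal.ofReal |f₁ y|) *
        (Q.vol⁻¹ * ∫⁻ y in Q.toSet, ENNReal.ofReal |f₂ y|)) x

/-- `(p)₋(Q)`, the essential infimum of `p` on a cube `Q`. -/
def pMinusOn {n : ℕ} (p : Rn n → ℝ) (Q : Cube n) : ℝ :=
  essInf p (volume.restrict Q.toSet)

/-- The exponent `q(Q)` with `1/q(Q) = 1/(p₁)₋(Q) + 1/(p₂)₋(Q)`. -/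
def qExp {n : ℕ} (p₁ p₂ : Rn n → ℝ) (Q : Cube n) : ℝ :=
  ((pMinusOn p₁ Q)⁻¹ + (pMinusOn p₂ Q)⁻¹)⁻¹

theorem Cube.toSet_eq_pi {n : ℕ} (Q : Cube n) :
    Q.toSet = Set.pi univ fun i => Ico (Q.base i) (Q.base i + Q.side) := by
  ext x
  simp [Cube.toSet]

theorem Cube.measurableSet_toSet {n : ℕ} (Q : Cube n) : MeasurableSet Q.toSet := by
  rw [Q.toSet_eq_pi]
  exact MeasurableSet.univ_pi fun _ => measurableSet_Ico

theorem Cube.volume_toSet {n : ℕ} (Q : Cube n) : volume Q.toSet = Q.vol := by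
  rw [Q.toSet_eq_pi, Real.volume_pi_Ico, Cube.vol, ENNReal.ofReal_pow Q.side_pos.le]
  simp

theorem Cube.vol_ne_zero {n : ℕ} (Q : Cube n) : Q.vol ≠ 0 := by
  simpa [Cube.vol] using pow_pos Q.side_pos n

theorem Cube.vol_ne_top {n : ℕ} (Q : Cube n) : Q.vol ≠ ∞ := ENNReal.ofReal_ne_top

theorem vNorm_indicator_mono {n : ℕ} (r : Rn n → ℝ≥0∞) (f : Rn n → ℝ) {s t : Set (Rn n)}
    (hst : s ⊆ t) : vNorm r (s.indicator f) ≤ vNorm r (t.indicator f) := by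
  have hle : ∀ (lam : ℝ≥0∞) (x : Rn n), ENNReal.ofReal |s.indicator f x| / lam ≤
      ENNReal.ofReal |t.indicator f x| / lam := by
    intro lam x
    refine ENNReal.div_le_div_right ?_ _
    by_cases hx : x ∈ s
    · simp [hx, hst hx]
    · simp [hx]
  refine sInf_le_sInf fun lam h => ⟨h.1, le_trans ?_ h.2⟩
  refine add_le_add (lintegral_mono fun x => ?_) (essSup_mono_ae (.of_forall fun x => hle lam x))
  exact ENNReal.rpow_le_rpow (hle lam x) ENNReal.toReal_nonneg

/-- The modular integral over a cube is at most one for every admissible scaling factor. -/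
theorem setLIntegral_le_one_of_eModular_le {n : ℕ} {r : Rn n → ℝ≥0∞} {a : Rn n → ℝ}
    (hr : ∀ᵐ x ∂(volume : Measure (Rn n)), r x = ENNReal.ofReal (a x))
    (ha : ∀ᵐ x ∂(volume : Measure (Rn n)), 0 ≤ a x)
    (f : Rn n → ℝ) {s : Set (Rn n)} (hs : MeasurableSet s) {lam : ℝ≥0∞}
    (h : eModular r volume (fun x => ENNReal.ofReal |s.indicator f x|) lam ≤ 1) :
    ∫⁻ x in s, (ENNReal.ofReal |f x| / lam) ^ a x ≤ 1 := by
  refine le_trans ?_ (le_trans le_self_add h)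
  have hfin : ∀ᵐ x ∂(volume : Measure (Rn n)), x ∈ {x | r x ≠ ∞} := by
    filter_upwards [hr] with x hx
    simp [hx]
  rw [Measure.restrict_eq_self_of_ae_mem hfin]
  refine le_trans (le_of_eq ?_) (setLIntegral_le_lintegral s _)
  refine setLIntegral_congr_fun_ae hs ?_
  filter_upwards [hr, ha] with x hx hax hxs
  simp [hx, hxs, ENNReal.toReal_ofReal hax]

theorem vNorm_indicator_ne_zero {n : ℕ} {r : Rn n → ℝ≥0∞} {a : Rn n → ℝ}
    (hr : ∀ᵐ x ∂(volume : Measure (Rn n)), r x = ENNReal.ofReal (a x))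
    (ham : Measurable a) (ha : ∀ᵐ x ∂(volume : Measure (Rn n)), 1 / 2 ≤ a x)
    {f : Rn n → ℝ} (hfm : Measurable f)
    (hf : ∀ᵐ x ∂(volume : Measure (Rn n)), 0 < f x) {s : Set (Rn n)}
    (hs : MeasurableSet s) (hs0 : volume s ≠ 0) : vNorm r (s.indicator f) ≠ 0 := by
  intro h0
  have key : ∀ ε : ℝ≥0∞, ε ≠ 0 → ε ≤ 1 →
      ∫⁻ x in s, ENNReal.ofReal |f x| ^ a x ≤ ε ^ (1 / 2 : ℝ) := by
    intro ε hε hε1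
    have hlt : sInf {lam : ℝ≥0∞ | lam ≠ 0 ∧
        eModular r volume (fun x => ENNReal.ofReal |s.indicator f x|) lam ≤ 1} < ε := by
      change vNorm r (s.indicator f) < ε
      rw [h0]
      exact pos_iff_ne_zero.2 hε
    obtain ⟨lam, ⟨hl0, hl⟩, hlε⟩ := sInf_lt_iff.1 hlt
    have hltop : lam ≠ ∞ := (hlε.trans_le (hε1.trans le_top)).ne
    have h1 := setLIntegral_le_one_of_eModular_le hr
      (ha.mono fun x hx => le_trans (by norm_num) hx) f hs hl
    calc ∫⁻ x in s, ENNReal.ofReal |f x| ^ a x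
        ≤ ∫⁻ x in s, lam ^ (1 / 2 : ℝ) * (ENNReal.ofReal |f x| / lam) ^ a x := by
          refine lintegral_mono_ae (ae_restrict_of_ae ?_)
          filter_upwards [ha] with x hx
          have hx0 : 0 ≤ a x := le_trans (by norm_num) hx
          calc ENNReal.ofReal |f x| ^ a x
              = lam ^ a x * (ENNReal.ofReal |f x| / lam) ^ a x := by
                rw [← ENNReal.mul_rpow_of_nonneg _ _ hx0, ENNReal.mul_div_cancel hl0 hltop]
            _ ≤ _ := by
                refine mul_le_mul_left (ENNReal.rpow_le_rpow_of_exponent_ge (hlε.le.trans hε1) hx) _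
      _ = lam ^ (1 / 2 : ℝ) * ∫⁻ x in s, (ENNReal.ofReal |f x| / lam) ^ a x :=
          lintegral_const_mul _ (by fun_prop)
      _ ≤ lam ^ (1 / 2 : ℝ) * 1 := by gcongr
      _ ≤ ε ^ (1 / 2 : ℝ) := by
          rw [mul_one]
          gcongr
  have hzero : ∫⁻ x in s, ENNReal.ofReal |f x| ^ a x = 0 := by
    by_contra hne
    set I := ∫⁻ x in s, ENNReal.ofReal |f x| ^ a x with hI
    have hI1 : I ≤ 1 := by simpa using key 1 one_ne_zero le_rfl
    have hItop : I ≠ ∞ := (hI1.trans_lt one_lt_top).ne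
    have hI2 : I / 2 ≠ 0 := by simpa using hne
    have h2 := key ((I / 2) ^ (2 : ℝ)) (by simp [hI2]) (by
      refine ENNReal.rpow_le_one ?_ (by norm_num)
      exact ENNReal.half_le_self.trans hI1)
    rw [← ENNReal.rpow_mul] at h2
    norm_num at h2
    exact absurd h2 (not_le.2 (ENNReal.half_lt_self hne hItop))
  rw [lintegral_eq_zero_iff (by fun_prop)] at hzero
  have hfalse : ∀ᵐ x ∂(volume.restrict s), False := by
    filter_upwards [hzero, ae_restrict_of_ae hf] with x hx hfx
    simp [ENNReal.rpow_eq_zero_iff, hfx.ne'] at hx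
  rw [Filter.eventually_false_iff_eq_bot, ae_eq_bot, Measure.restrict_eq_zero] at hfalse
  exact hs0 hfalse

theorem le_mul_vNorm {n : ℕ} {r : Rn n → ℝ≥0∞} {f : Rn n → ℝ} {X Y : ℝ≥0∞}
    (hY0 : Y ≠ 0) (hf : vNorm r f ≠ 0)
    (h : ∀ lam : ℝ≥0∞, lam ≠ 0 → eModular r volume (fun x => ENNReal.ofReal |f x|) lam ≤ 1 →
      X ≤ Y * lam) : X ≤ Y * vNorm r f := by
  by_cases hY : Y = ∞
  · simp [hY, ENNReal.top_mul hf]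
  · rw [← ENNReal.div_le_iff' hY0 hY]
    refine le_sInf fun lam hl => ?_
    rw [ENNReal.div_le_iff' hY0 hY]
    exact h lam hl.1 hl.2

/-- A three-term Young inequality without sharp constants. -/
theorem rpow_half_mul_le {X Y Z : ℝ≥0∞} {a b c : ℝ} (ha : 0 < a) (hb : 0 < b) (hc : 0 < c)
    (h : 1 / a + 1 / b + 1 / c = 2) :
    (X * Y * Z) ^ (1 / 2 : ℝ) ≤ X ^ a + Y ^ b + Z ^ c := by
  set M := X ^ a + Y ^ b + Z ^ c with hM
  have aux : ∀ {U : ℝ≥0∞} {d : ℝ}, 0 < d → U ^ d ≤ M → U ≤ M ^ (1 / d) := by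
    intro U d hd hU
    rw [one_div, ENNReal.le_rpow_inv_iff hd]
    exact hU
  have hX := aux ha (U := X) (le_self_add.trans le_self_add)
  have hY := aux hb (U := Y) (le_add_self.trans le_self_add)
  have hZ := aux hc (U := Z) le_add_self
  calc (X * Y * Z) ^ (1 / 2 : ℝ) ≤ (M ^ (1 / a) * M ^ (1 / b) * M ^ (1 / c)) ^ (1 / 2 : ℝ) := by
        gcongr
    _ = M := by
        rw [← ENNReal.rpow_add_of_nonneg _ _ (by positivity) (by positivity),
          ← ENNReal.rpow_add_of_nonneg _ _ (by positivity) (by positivity), h,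
          ← ENNReal.rpow_mul]
        norm_num

theorem conjExp_eq_ofReal {n : ℕ} {p : Rn n → ℝ} {x : Rn n} (h : 1 < p x) :
    conjExp p x = ENNReal.ofReal (p x / (p x - 1)) := by
  have h1 : ENNReal.ofReal (p x) ≠ 1 := by
    rw [Ne, ENNReal.ofReal_eq_one]
    exact h.ne'
  simp [conjExp, econj, h1, ENNReal.toReal_ofReal (zero_le_one.trans h.le)]

theorem one_le_conj {t : ℝ} (h : 1 < t) : 1 ≤ t / (t - 1) := by
  rw [le_div_iff₀ (by linarith)]
  linarith

/-- A three-factor Hölder inequality over a cube, for weights `w`, `1 / w₁`, `1 / w₂` and the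
exponent `p` together with the conjugates of `p₁` and `p₂`. -/
theorem sq_vol_le_mul_vNorm {n : ℕ} {p₁ p₂ p w₁ w₂ w : Rn n → ℝ}
    (hp₁m : Measurable p₁) (hp₂m : Measurable p₂)
    (hp₁ : ∀ᵐ x ∂(volume : Measure (Rn n)), 1 < p₁ x)
    (hp₂ : ∀ᵐ x ∂(volume : Measure (Rn n)), 1 < p₂ x)
    (hp : ∀ x, 1 / p x = 1 / p₁ x + 1 / p₂ x)
    (hw₁ : IsWeight w₁) (hw₂ : IsWeight w₂) (hw : ∀ x, w x = w₁ x * w₂ x) (Q : Cube n) :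
    vNorm (ofExp p) (Q.toSet.indicator w) ≠ 0 ∧
    vNorm (conjExp p₁) (Q.toSet.indicator fun x => (w₁ x)⁻¹) ≠ 0 ∧
    vNorm (conjExp p₂) (Q.toSet.indicator fun x => (w₂ x)⁻¹) ≠ 0 ∧
    Q.vol ^ 2 ≤ 9 * vNorm (ofExp p) (Q.toSet.indicator w) *
      vNorm (conjExp p₁) (Q.toSet.indicator fun x => (w₁ x)⁻¹) *
      vNorm (conjExp p₂) (Q.toSet.indicator fun x => (w₂ x)⁻¹) := by
  have hpeq : p = fun x => (1 / p₁ x + 1 / p₂ x)⁻¹ := by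
    funext x
    rw [← hp x]
    simp
  have hpm : Measurable p := by
    rw [hpeq]
    fun_prop
  have hweq : w = fun x => w₁ x * w₂ x := funext hw
  have hwm : Measurable w := by
    rw [hweq]
    exact hw₁.1.mul hw₂.1
  have hw0 : ∀ᵐ x ∂(volume : Measure (Rn n)), 0 < w x := by
    filter_upwards [hw₁.2, hw₂.2] with x h1 h2
    rw [hw x]
    positivity
  have hwi₁ : ∀ᵐ x ∂(volume : Measure (Rn n)), 0 < (w₁ x)⁻¹ := hw₁.2.mono fun x hx => inv_pos.2 hx
  have hwi₂ : ∀ᵐ x ∂(volume : Measure (Rn n)), 0 < (w₂ x)⁻¹ := hw₂.2.mono fun x hx => inv_pos.2 hx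
  have hr₁ := hp₁.mono fun x hx => conjExp_eq_ofReal hx
  have hr₂ := hp₂.mono fun x hx => conjExp_eq_ofReal hx
  have hr : ∀ᵐ x ∂(volume : Measure (Rn n)), ofExp p x = ENNReal.ofReal (p x) :=
    .of_forall fun x => rfl
  have ha₁ := hp₁.mono fun x hx => one_le_conj hx
  have ha₂ := hp₂.mono fun x hx => one_le_conj hx
  have ha : ∀ᵐ x ∂(volume : Measure (Rn n)), 1 / 2 ≤ p x := by
    filter_upwards [hp₁, hp₂] with x h1 h2
    have h3 : 1 / p₁ x ≤ 1 := by
      rw [div_le_one (by linarith)]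
      exact h1.le
    have h4 : 1 / p₂ x ≤ 1 := by
      rw [div_le_one (by linarith)]
      exact h2.le
    have h5 : 0 < 1 / p₁ x := by positivity
    have h6 : 0 < 1 / p₂ x := by positivity
    rw [congrFun hpeq x, ← one_div]
    exact one_div_le_one_div_of_le (by linarith) (by linarith)
  have hQm := Q.measurableSet_toSet
  have hQ0 : volume Q.toSet ≠ 0 := by
    rw [Q.volume_toSet]
    exact Q.vol_ne_zero
  have hN := vNorm_indicator_ne_zero hr hpm ha hwm hw0 hQm hQ0
  have hN₁ : vNorm (conjExp p₁) (Q.toSet.indicator fun x => (w₁ x)⁻¹) ≠ 0 :=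
    vNorm_indicator_ne_zero hr₁ (by fun_prop)
    (ha₁.mono fun x hx => le_trans (by norm_num) hx) hw₁.1.inv hwi₁ hQm hQ0
  have hN₂ : vNorm (conjExp p₂) (Q.toSet.indicator fun x => (w₂ x)⁻¹) ≠ 0 :=
    vNorm_indicator_ne_zero hr₂ (by fun_prop)
    (ha₂.mono fun x hx => le_trans (by norm_num) hx) hw₂.1.inv hwi₂ hQm hQ0
  refine ⟨hN, hN₁, hN₂, ?_⟩
  have key : ∀ l l₁ l₂ : ℝ≥0∞, l ≠ 0 → l₁ ≠ 0 → l₂ ≠ 0 →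
      eModular (ofExp p) volume (fun x => ENNReal.ofReal |Q.toSet.indicator w x|) l ≤ 1 →
      eModular (conjExp p₁) volume
        (fun x => ENNReal.ofReal |Q.toSet.indicator (fun x => (w₁ x)⁻¹) x|) l₁ ≤ 1 →
      eModular (conjExp p₂) volume
        (fun x => ENNReal.ofReal |Q.toSet.indicator (fun x => (w₂ x)⁻¹) x|) l₂ ≤ 1 →
      Q.vol ^ 2 ≤ 9 * l * l₁ * l₂ := by
    intro l l₁ l₂ hl hl₁ hl₂ h h₁ h₂
    have i := setLIntegral_le_one_of_eModular_le hr
      (ha.mono fun x hx => le_trans (by norm_num) hx) w hQm h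
    have i₁ := setLIntegral_le_one_of_eModular_le hr₁
      (ha₁.mono fun x hx => le_trans (by norm_num) hx) _ hQm h₁
    have i₂ := setLIntegral_le_one_of_eModular_le hr₂
      (ha₂.mono fun x hx => le_trans (by norm_num) hx) _ hQm h₂
    have m₁ := hw₁.1
    have m₂ := hw₂.1
    set L := l⁻¹ * l₁⁻¹ * l₂⁻¹ with hL
    have hpt : ∀ᵐ x ∂(volume.restrict Q.toSet), L ^ (1 / 2 : ℝ) ≤
        (ENNReal.ofReal |w x| / l) ^ p x +
        (ENNReal.ofReal |(w₁ x)⁻¹| / l₁) ^ (p₁ x / (p₁ x - 1)) +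
        (ENNReal.ofReal |(w₂ x)⁻¹| / l₂) ^ (p₂ x / (p₂ x - 1)) := by
      refine ae_restrict_of_ae ?_
      filter_upwards [hp₁, hp₂, hw₁.2, hw₂.2, ha, ha₁, ha₂] with x x₁ x₂ y₁ y₂ z z₁ z₂
      refine le_trans (le_of_eq ?_) (rpow_half_mul_le (by linarith) (by linarith)
        (by linarith) ?_)
      · congr 1
        have hone : ENNReal.ofReal |w x| * ENNReal.ofReal |(w₁ x)⁻¹| *
            ENNReal.ofReal |(w₂ x)⁻¹| = 1 := by
          rw [← ENNReal.ofReal_mul (by positivity), ← ENNReal.ofReal_mul (by positivity),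
            ← abs_mul, ← abs_mul, hw x]
          have : w₁ x * w₂ x * (w₁ x)⁻¹ * (w₂ x)⁻¹ = 1 := by field_simp
          simp [this]
        calc L = 1 * L := (one_mul _).symm
          _ = _ := by
            rw [← hone, hL]
            simp only [div_eq_mul_inv]
            ring
      · rw [hp x]
        have : p₁ x - 1 ≠ 0 := by linarith
        have : p₂ x - 1 ≠ 0 := by linarith
        field_simp
        ring
    have hint : L ^ (1 / 2 : ℝ) * Q.vol ≤ 3 := by
      calc L ^ (1 / 2 : ℝ) * Q.vol = ∫⁻ x in Q.toSet, L ^ (1 / 2 : ℝ) := by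
            rw [setLIntegral_const, Q.volume_toSet]
        _ ≤ _ := lintegral_mono_ae hpt
        _ ≤ 1 + 1 + 1 := by
            rw [lintegral_add_left (by fun_prop), lintegral_add_left (by fun_prop)]
            gcongr
        _ = 3 := by norm_num
    have hsq : L * Q.vol ^ 2 ≤ 9 := by
      calc L * Q.vol ^ 2 = (L ^ (1 / 2 : ℝ) * Q.vol) ^ 2 := by
            rw [mul_pow, ← ENNReal.rpow_natCast (L ^ (1 / 2 : ℝ)), ← ENNReal.rpow_mul]
            norm_num
        _ ≤ 3 ^ 2 := by gcongr
        _ = 9 := by norm_num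
    have hLinv : L = (l * l₁ * l₂)⁻¹ := by
      rw [ENNReal.mul_inv (.inl (mul_ne_zero hl hl₁)) (.inr hl₂),
        ENNReal.mul_inv (.inl hl) (.inr hl₁)]
    rw [hLinv, mul_comm, ← div_eq_mul_inv] at hsq
    by_cases htop : l * l₁ * l₂ = ∞
    · have : 9 * l * l₁ * l₂ = ∞ := by
        rw [mul_assoc 9, mul_assoc 9, htop]
        exact ENNReal.mul_top (by norm_num)
      rw [this]
      exact le_top
    · rw [ENNReal.div_le_iff (mul_ne_zero (mul_ne_zero hl hl₁) hl₂) htop] at hsq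
      simpa [mul_assoc] using hsq
  refine le_mul_vNorm (by simp [hN, hN₁]) hN₂ fun l₂ hl₂ h₂ => ?_
  rw [mul_right_comm]
  refine le_mul_vNorm (by simp [hN, hl₂]) hN₁ fun l₁ hl₁ h₁ => ?_
  rw [mul_right_comm, mul_right_comm 9]
  rw [mul_right_comm]
  refine le_mul_vNorm (by simp [hl₁, hl₂]) hN fun l hl h => ?_
  refine (key l l₁ l₂ hl hl₁ hl₂ h h₁ h₂).trans (le_of_eq ?_)
  ring

/-- Oscillation bound over cubes for log-Hölder continuous exponents. -/
theorem LH.exists_osc_mul_log_le {n : ℕ} {p : Rn n → ℝ} (h1 : ∀ x, 1 ≤ p x) (h : LH p) :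
    ∃ K : ℝ, 0 ≤ K ∧ ∀ Q : Cube n, ∀ x ∈ Q.toSet, ∀ y ∈ Q.toSet,
      |1 / p x - 1 / p y| * Real.log ((1 + Q.side + ‖Q.base‖) / Q.side) ≤ K := by
  obtain ⟨⟨C₀, hC₀, h0⟩, pinf, -, C, hC, hinf⟩ := h
  refine ⟨6 + 2 * C + C₀, by positivity, fun Q x hx y hy => ?_⟩
  have hl := Q.side_pos
  set l := Q.side with hldef
  set t := |1 / p x - 1 / p y| with ht
  set m := min ‖x‖ ‖y‖ with hm
  have hm0 : 0 ≤ m := le_min (norm_nonneg _) (norm_nonneg _)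
  have he : 2 < Real.exp 1 := lt_trans (by norm_num) Real.exp_one_gt_d9
  have ht0 : 0 ≤ t := abs_nonneg _
  have hp01 : ∀ z, 0 ≤ 1 / p z ∧ 1 / p z ≤ 1 := fun z =>
    ⟨one_div_nonneg.2 (zero_le_one.trans (h1 z)),
      (div_le_one (zero_lt_one.trans_le (h1 z))).2 (h1 z)⟩
  have ht1 : t ≤ 1 := by
    rw [ht, abs_le]
    constructor <;> linarith [(hp01 x).1, (hp01 x).2, (hp01 y).1, (hp01 y).2]
  have hlogm : 0 < Real.log (Real.exp 1 + m) := Real.log_pos (by linarith)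
  have htinf : t * Real.log (Real.exp 1 + m) ≤ 2 * C := by
    have aux : ∀ z : Rn n, m ≤ ‖z‖ → |1 / p z - 1 / pinf| ≤ C / Real.log (Real.exp 1 + m) := by
      intro z hz
      refine (hinf z).trans (div_le_div_of_nonneg_left hC.le hlogm ?_)
      exact Real.log_le_log (by linarith) (by linarith)
    have hx' := aux x (min_le_left _ _)
    have hy' := aux y (min_le_right _ _)
    rw [← le_div_iff₀ hlogm]
    calc t = |(1 / p x - 1 / pinf) - (1 / p y - 1 / pinf)| := by rw [ht]; congr 1; ring
      _ ≤ |1 / p x - 1 / pinf| + |1 / p y - 1 / pinf| := abs_sub _ _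
      _ ≤ C / Real.log (Real.exp 1 + m) + C / Real.log (Real.exp 1 + m) := add_le_add hx' hy'
      _ = 2 * C / Real.log (Real.exp 1 + m) := by ring
  have hdist : ∀ u v : Rn n, (∀ i, Q.base i ≤ u i ∧ u i ≤ Q.base i + l) →
      (∀ i, Q.base i ≤ v i ∧ v i ≤ Q.base i + l) → dist u v ≤ l := by
    intro u v hu hv
    rw [dist_pi_le_iff hl.le]
    intro i
    rw [Real.dist_eq, abs_le]
    constructor <;> linarith [(hu i).1, (hu i).2, (hv i).1, (hv i).2]
  have hmem : ∀ z ∈ Q.toSet, ∀ i, Q.base i ≤ z i ∧ z i ≤ Q.base i + l :=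
    fun z hz i => ⟨(hz i).1, (hz i).2.le⟩
  have hbase : ∀ z ∈ Q.toSet, ‖Q.base‖ ≤ ‖z‖ + l := by
    intro z hz
    have h2 := hdist Q.base z (fun i => ⟨le_rfl, by linarith⟩) (hmem z hz)
    rw [dist_eq_norm] at h2
    have h3 := norm_sub_norm_le Q.base z
    linarith
  have hbm : ‖Q.base‖ ≤ m + l := by
    rcases min_choice ‖x‖ ‖y‖ with h2 | h2
    · rw [hm, h2]
      exact hbase x hx
    · rw [hm, h2]
      exact hbase y hy
  have hR : 0 < 1 + l + ‖Q.base‖ := by positivity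
  rcases le_or_gt (1 / 4) l with hl4 | hl4
  · have hle : (1 + l + ‖Q.base‖) / l ≤ 6 * (Real.exp 1 + m) := by
      rw [div_le_iff₀ hl]
      nlinarith
    have hlog : Real.log ((1 + l + ‖Q.base‖) / l) ≤ 6 + Real.log (Real.exp 1 + m) := by
      refine (Real.log_le_log (by positivity) hle).trans ?_
      rw [Real.log_mul (by norm_num) (by linarith)]
      have : Real.log 6 ≤ 6 := Real.log_le_self (by norm_num)
      linarith
    calc t * Real.log ((1 + l + ‖Q.base‖) / l) ≤ t * (6 + Real.log (Real.exp 1 + m)) := by gcongr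
      _ = t * 6 + t * Real.log (Real.exp 1 + m) := by ring
      _ ≤ 6 + 2 * C + C₀ := by linarith
  · have hlogl : 0 < -Real.log l := by
      have := Real.log_neg hl (by linarith)
      linarith
    have hlog : Real.log ((1 + l + ‖Q.base‖) / l) ≤ Real.log (Real.exp 1 + m) + -Real.log l := by
      rw [Real.log_div hR.ne' hl.ne']
      have := Real.log_le_log hR (show 1 + l + ‖Q.base‖ ≤ Real.exp 1 + m by linarith)
      linarith
    have htl : t * -Real.log l ≤ C₀ := by
      have hd := hdist x y (hmem x hx) (hmem y hy)
      rcases (dist_nonneg (x := x) (y := y)).eq_or_lt with hd0 | hd0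
      · have : x = y := dist_eq_zero.1 hd0.symm
        have : t = 0 := by rw [ht, this]; simp
        rw [this]
        linarith
      · have h2 := h0 x y (by linarith)
        have h3 := Real.log_le_log hd0 hd
        rw [← le_div_iff₀ hlogl]
        exact h2.trans (div_le_div_of_nonneg_left hC₀.le hlogl (by linarith))
    calc t * Real.log ((1 + l + ‖Q.base‖) / l)
        ≤ t * (Real.log (Real.exp 1 + m) + -Real.log l) := by gcongr
      _ = t * Real.log (Real.exp 1 + m) + t * -Real.log l := by ring
      _ ≤ 6 + 2 * C + C₀ := by linarith

/-- Polynomial lower bound for the norms of the dual weight over cubes. -/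
theorem ApVec.exists_le_vNorm {n : ℕ} {p₁ p₂ p w₁ w₂ w : Rn n → ℝ}
    (hp₁m : Measurable p₁) (hp₂m : Measurable p₂)
    (hp₁ : ∀ᵐ x ∂(volume : Measure (Rn n)), 1 < p₁ x)
    (hp₂ : ∀ᵐ x ∂(volume : Measure (Rn n)), 1 < p₂ x)
    (hp : ∀ x, 1 / p x = 1 / p₁ x + 1 / p₂ x)
    (hw₁ : IsWeight w₁) (hw₂ : IsWeight w₂) (hw : ∀ x, w x = w₁ x * w₂ x)
    (hA : ApVec p₁ p₂ p w₁ w₂ w) :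
    ∃ c : ℝ, 0 < c ∧ c ≤ 1 ∧ ∀ Q : Cube n,
      ENNReal.ofReal (c * (Q.side / (1 + Q.side + ‖Q.base‖)) ^ (2 * n)) ≤
        vNorm (conjExp p₁) (Q.toSet.indicator fun x => (w₁ x)⁻¹) := by
  obtain ⟨A, hAtop, hA⟩ := hA
  set N : Cube n → ℝ≥0∞ := fun Q =>
    vNorm (conjExp p₁) (Q.toSet.indicator fun x => (w₁ x)⁻¹) with hN
  have hH := sq_vol_le_mul_vNorm hp₁m hp₂m hp₁ hp₂ hp hw₁ hw₂ hw
  have hsub : ∀ Q Q' : Cube n, Q.toSet ⊆ Q'.toSet →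
      Q.vol ^ 2 * N Q' ≤ 9 * A * Q'.vol ^ 2 * N Q := by
    intro Q Q' hQ
    have hA' : vNorm (ofExp p) (Q'.toSet.indicator w) * N Q' *
        vNorm (conjExp p₂) (Q'.toSet.indicator fun x => (w₂ x)⁻¹) ≤ Q'.vol ^ 2 * A := by
      have h1 := hA Q'
      rw [mul_assoc, mul_assoc, ← ENNReal.inv_pow, mul_comm, ← div_eq_mul_inv,
        ENNReal.div_le_iff (pow_ne_zero _ Q'.vol_ne_zero)
        (ENNReal.pow_ne_top Q'.vol_ne_top)] at h1
      rw [mul_assoc, mul_comm _ A]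
      exact h1
    calc Q.vol ^ 2 * N Q'
        ≤ (9 * vNorm (ofExp p) (Q.toSet.indicator w) * N Q *
          vNorm (conjExp p₂) (Q.toSet.indicator fun x => (w₂ x)⁻¹)) * N Q' :=
          mul_le_mul_left (hH Q).2.2.2 _
      _ ≤ (9 * vNorm (ofExp p) (Q'.toSet.indicator w) * N Q *
          vNorm (conjExp p₂) (Q'.toSet.indicator fun x => (w₂ x)⁻¹)) * N Q' := by
          refine mul_le_mul_left ?_ _
          refine mul_le_mul' (mul_le_mul_left (mul_le_mul_right ?_ _) _) ?_ <;>
          exact vNorm_indicator_mono _ _ hQ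
      _ = 9 * (vNorm (ofExp p) (Q'.toSet.indicator w) * N Q' *
          vNorm (conjExp p₂) (Q'.toSet.indicator fun x => (w₂ x)⁻¹)) * N Q := by ring
      _ ≤ 9 * (Q'.vol ^ 2 * A) * N Q := mul_le_mul_left (mul_le_mul_right hA' _) _
      _ = 9 * A * Q'.vol ^ 2 * N Q := by ring
  set Q₁ : Cube n := ⟨fun _ => -1, 2, by norm_num⟩ with hQ₁
  obtain ⟨d, hd0, hd1, hd⟩ : ∃ d : ℝ, 0 < d ∧ d ≤ 1 ∧ ENNReal.ofReal d ≤ N Q₁ := by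
    have hmin : min 1 (N Q₁) ≠ ∞ := ((min_le_left _ _).trans_lt one_lt_top).ne
    refine ⟨(min 1 (N Q₁)).toReal, ENNReal.toReal_pos ?_ hmin, ?_, ?_⟩
    · have h1 : 0 < N Q₁ := pos_iff_ne_zero.2 (hH Q₁).2.1
      exact (lt_min zero_lt_one h1).ne'
    · exact ENNReal.toReal_le_of_le_ofReal zero_le_one (by simp)
    · rw [ENNReal.ofReal_toReal hmin]
      exact min_le_right _ _
  set k : ℝ := 9 * A.toReal + 1 with hk
  have hAk : 9 * A ≤ ENNReal.ofReal k := by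
    rw [hk, ENNReal.ofReal_add (by positivity) zero_le_one, ENNReal.ofReal_mul (by norm_num),
      ENNReal.ofReal_toReal hAtop]
    simp
  have hk1 : 1 ≤ k := by
    rw [hk]
    linarith [ENNReal.toReal_nonneg (a := A)]
  have hk0 : 0 < k := by linarith
  have hfour : (1 : ℝ) ≤ 2 ^ (2 * n) := one_le_pow₀ (by norm_num)
  refine ⟨d / (k * 2 ^ (2 * n)), by positivity, ?_, fun Q => ?_⟩
  · rw [div_le_one (by positivity)]
    nlinarith
  have hl := Q.side_pos
  set R := 1 + Q.side + ‖Q.base‖ with hR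
  have hb := norm_nonneg Q.base
  have hR1 : 1 ≤ R := by linarith
  have hR0 : 0 < R := by linarith
  set Q' : Cube n := ⟨fun _ => -R, 2 * R, by linarith⟩ with hQ'
  have hQQ' : Q.toSet ⊆ Q'.toSet := by
    intro x hx i
    have h1 := norm_le_pi_norm Q.base i
    rw [Real.norm_eq_abs, abs_le] at h1
    have h2 := hx i
    simp only [hQ']
    constructor <;> linarith
  have hQ₁Q' : Q₁.toSet ⊆ Q'.toSet := by
    intro x hx i
    have h2 := hx i
    simp only [hQ₁] at h2
    simp only [hQ']
    constructor <;> linarith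
  have hfin : ENNReal.ofReal (Q.side ^ (2 * n) * d) ≤
      ENNReal.ofReal (k * (2 * R) ^ (2 * n)) * N Q := by
    calc ENNReal.ofReal (Q.side ^ (2 * n) * d) = Q.vol ^ 2 * ENNReal.ofReal d := by
          rw [Cube.vol, ← ENNReal.ofReal_pow (by positivity), ← pow_mul, mul_comm n 2,
            ENNReal.ofReal_mul (by positivity)]
      _ ≤ Q.vol ^ 2 * N Q' :=
          mul_le_mul_right (hd.trans (vNorm_indicator_mono _ _ hQ₁Q')) _
      _ ≤ 9 * A * Q'.vol ^ 2 * N Q := hsub Q Q' hQQ'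
      _ ≤ ENNReal.ofReal k * Q'.vol ^ 2 * N Q :=
          mul_le_mul_left (mul_le_mul_left hAk _) _
      _ = ENNReal.ofReal (k * (2 * R) ^ (2 * n)) * N Q := by
          rw [Cube.vol, ← ENNReal.ofReal_pow (by positivity), ← pow_mul, mul_comm n 2,
            ENNReal.ofReal_mul hk0.le]
  have hpos : 0 < k * (2 * R) ^ (2 * n) := by positivity
  rw [← ENNReal.div_le_iff' (by simpa using hpos) ENNReal.ofReal_ne_top,
    ← ENNReal.ofReal_div_of_pos hpos] at hfin
  refine le_trans (le_of_eq ?_) hfin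
  congr 1
  rw [mul_pow, div_pow]
  field_simp

theorem pMinusOn_le {n : ℕ} {p : Rn n → ℝ} (h1 : ∀ x, 1 ≤ p x) (Q : Cube n) :
    ∀ᵐ x ∂(volume.restrict Q.toSet), pMinusOn p Q ≤ p x :=
  ae_essInf_le ⟨1, by simpa using Filter.Eventually.of_forall h1⟩

theorem le_pMinusOn {n : ℕ} {p : Rn n → ℝ} {b c : ℝ}
    (hb : ∀ᵐ x ∂(volume : Measure (Rn n)), p x ≤ b) (Q : Cube n)
    (hc : ∀ᵐ x ∂(volume.restrict Q.toSet), c ≤ p x) : c ≤ pMinusOn p Q := by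
  have hne : (ae (volume.restrict Q.toSet)).NeBot := by
    rw [ae_neBot, Ne, Measure.restrict_eq_zero, Q.volume_toSet]
    exact Q.vol_ne_zero
  have hbd : Filter.IsBoundedUnder (· ≤ ·) (ae (volume.restrict Q.toSet)) p :=
    ⟨b, by simpa using ae_restrict_of_ae hb⟩
  exact Filter.le_liminf_of_le hbd.isCoboundedUnder_ge hc

theorem pMinusOn_le_of_ae_le {n : ℕ} {p : Rn n → ℝ} {b : ℝ} (h1 : ∀ x, 1 ≤ p x)
    (hb : ∀ᵐ x ∂(volume : Measure (Rn n)), p x ≤ b) (Q : Cube n) : pMinusOn p Q ≤ b := by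
  have hne : (ae (volume.restrict Q.toSet)).NeBot := by
    rw [ae_neBot, Ne, Measure.restrict_eq_zero, Q.volume_toSet]
    exact Q.vol_ne_zero
  obtain ⟨x, hx, hx'⟩ := ((pMinusOn_le h1 Q).and (ae_restrict_of_ae hb)).exists
  exact hx.trans hx'

/-- Comparison of powers of `L` whose exponents are the conjugates of `v` and of `u ≤ v`. -/
theorem rpow_conj_le {L B κ u v : ℝ} (hL : 0 < L) (hB : 0 ≤ B) (hu : 1 < u) (huv : u ≤ v)
    (hκ : u / (u - 1) ≤ κ) (h : L < 1 → (1 / u - 1 / v) * -Real.log L ≤ B) :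
    L ^ (v / (v - 1)) ≤ Real.exp (κ ^ 2 * B) * L ^ (u / (u - 1)) := by
  have hv : 1 < v := hu.trans_le huv
  have hu1 : 0 < u - 1 := by linarith
  have hv1 : 0 < v - 1 := by linarith
  have hle : v / (v - 1) ≤ u / (u - 1) := by
    rw [div_le_div_iff₀ hv1 hu1]
    nlinarith
  have hE : 1 ≤ Real.exp (κ ^ 2 * B) := Real.one_le_exp (by positivity)
  rcases le_or_gt 1 L with h1 | h1
  · have h2 := Real.rpow_le_rpow_of_exponent_le h1 hle
    have h3 : 0 ≤ L ^ (u / (u - 1)) := by positivity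
    nlinarith
  · have h2 := h h1
    rw [Real.rpow_def_of_pos hL, Real.rpow_def_of_pos hL, ← Real.exp_add, Real.exp_le_exp]
    have hid : u / (u - 1) - v / (v - 1) =
        (u / (u - 1)) * (v / (v - 1)) * (1 / u - 1 / v) := by
      field_simp
      ring
    have hmul : (u / (u - 1)) * (v / (v - 1)) ≤ κ ^ 2 := by
      rw [sq]
      have hu0 : 0 ≤ u / (u - 1) := by positivity
      exact mul_le_mul hκ (hle.trans hκ) (by positivity) (hu0.trans hκ)
    have h5 : (u / (u - 1) - v / (v - 1)) * -Real.log L ≤ κ ^ 2 * B := by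
      rw [hid, mul_assoc]
      have : 0 ≤ (u / (u - 1)) * (v / (v - 1)) := by positivity
      calc _ ≤ (u / (u - 1)) * (v / (v - 1)) * B := by gcongr
        _ ≤ κ ^ 2 * B := by gcongr
    linarith

/-- Linear form of the estimate for a single weight. -/
theorem exists_div_vNorm_le {n : ℕ} {p w σ : Rn n → ℝ} (hpm : Measurable p)
    (h1 : ∀ x, 1 ≤ p x) {a b : ℝ} (ha1 : 1 < a)
    (hab : ∀ᵐ x ∂(volume : Measure (Rn n)), a ≤ p x ∧ p x ≤ b) (hLH : LH p) (hw : IsWeight w)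
    (hσ : ∀ x, σ x = w x ^ (-(p x / (p x - 1)))) {c : ℝ} (hc0 : 0 < c) (hc1 : c ≤ 1)
    (hN0 : ∀ Q : Cube n, vNorm (conjExp p) (Q.toSet.indicator fun x => (w x)⁻¹) ≠ 0)
    (hc : ∀ Q : Cube n, ENNReal.ofReal (c * (Q.side / (1 + Q.side + ‖Q.base‖)) ^ (2 * n)) ≤
      vNorm (conjExp p) (Q.toSet.indicator fun x => (w x)⁻¹)) :
    ∃ E : ℝ, 1 ≤ E ∧ ∀ Q : Cube n,
      (∫⁻ y in Q.toSet, ENNReal.ofReal (σ y)) /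
        vNorm (conjExp p) (Q.toSet.indicator fun x => (w x)⁻¹) ≤
      ENNReal.ofReal E * (∫⁻ y in Q.toSet, ENNReal.ofReal (σ y)) ^ (1 / pMinusOn p Q) := by
  obtain ⟨K, hK0, hK⟩ := hLH.exists_osc_mul_log_le h1
  set B := -Real.log c + 2 * n * K with hB
  have hlogc : 0 ≤ -Real.log c := by
    have := Real.log_nonpos hc0.le hc1
    linarith
  have hB0 : 0 ≤ B := by positivity
  set κ := a / (a - 1) with hκ
  set E := Real.exp (κ ^ 2 * B) with hE
  have hE1 : 1 ≤ E := Real.one_le_exp (by positivity)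
  have hp1 : ∀ᵐ x ∂(volume : Measure (Rn n)), 1 < p x := hab.mono fun x hx => ha1.trans_le hx.1
  refine ⟨E, hE1, fun Q => ?_⟩
  set P := pMinusOn p Q with hP
  set S := ∫⁻ y in Q.toSet, ENNReal.ofReal (σ y) with hS
  set N := vNorm (conjExp p) (Q.toSet.indicator fun x => (w x)⁻¹) with hN
  have haP : a ≤ P := le_pMinusOn (hab.mono fun x hx => hx.2) Q
    (ae_restrict_of_ae (hab.mono fun x hx => hx.1))
  have hP1 : 1 < P := ha1.trans_le haP
  have hP1' : 0 < P - 1 := by linarith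
  have hPle := pMinusOn_le h1 Q
  have hPκ : P / (P - 1) ≤ κ := by
    rw [hκ, div_le_div_iff₀ hP1' (by linarith)]
    nlinarith
  have hpow : S ^ (1 - 1 / P) ≤ ENNReal.ofReal E * N := by
    refine le_mul_vNorm (by simpa using zero_lt_one.trans_le hE1) (hN0 Q) fun lam hl0 hl => ?_
    by_cases hltop : lam = ∞
    · rw [hltop, ENNReal.mul_top (by simpa using zero_lt_one.trans_le hE1)]
      exact le_top
    set L := lam.toReal with hLdef
    have hL0 : 0 < L := ENNReal.toReal_pos hl0 hltop
    have hlamL : lam = ENNReal.ofReal L := (ENNReal.ofReal_toReal hltop).symm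
    have hNl : N ≤ lam := sInf_le ⟨hl0, hl⟩
    have hQl := Q.side_pos
    set R := 1 + Q.side + ‖Q.base‖ with hR
    have hR0 : 0 < R := by positivity
    have hcL : c * (Q.side / R) ^ (2 * n) ≤ L := by
      have h2 := (hc Q).trans hNl
      rwa [hlamL, ENNReal.ofReal_le_ofReal_iff hL0.le] at h2
    have hlogL : -Real.log L ≤ -Real.log c + 2 * n * Real.log (R / Q.side) := by
      have h2 := Real.log_le_log (by positivity) hcL
      rw [Real.log_mul hc0.ne' (by positivity), Real.log_pow, ← inv_div, Real.log_inv] at h2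
      push_cast at h2
      linarith
    have hosc : ∀ x ∈ Q.toSet, ∀ y ∈ Q.toSet,
        (1 / p y - 1 / p x) * -Real.log L ≤ B ∨ 1 ≤ L := by
      intro x hx y hy
      rcases le_or_gt 1 L with hL1 | hL1
      · exact .inr hL1
      left
      have hnl : 0 < -Real.log L := by
        have := Real.log_neg hL0 hL1
        linarith
      have ht := hK Q y hy x hx
      set t := |1 / p y - 1 / p x| with htdef
      have ht0 : 0 ≤ t := abs_nonneg _
      have ht1 : t ≤ 1 := by
        have hp01 : ∀ z, 0 ≤ 1 / p z ∧ 1 / p z ≤ 1 := fun z =>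
          ⟨one_div_nonneg.2 (zero_le_one.trans (h1 z)),
            (div_le_one (zero_lt_one.trans_le (h1 z))).2 (h1 z)⟩
        rw [htdef, abs_le]
        constructor <;> linarith [(hp01 x).1, (hp01 x).2, (hp01 y).1, (hp01 y).2]
      calc (1 / p y - 1 / p x) * -Real.log L ≤ t * -Real.log L := by
            gcongr
            exact le_abs_self _
        _ ≤ t * (-Real.log c + 2 * n * Real.log (R / Q.side)) := by gcongr
        _ = t * -Real.log c + 2 * n * (t * Real.log (R / Q.side)) := by ring
        _ ≤ 1 * -Real.log c + 2 * n * K := by gcongr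
        _ = B := by rw [hB, one_mul]
    have hpt : ∀ᵐ x ∂(volume.restrict Q.toSet), L ^ (p x / (p x - 1)) ≤ E * L ^ (P / (P - 1)) := by
      filter_upwards [hPle, ae_restrict_mem Q.measurableSet_toSet] with x hx hxQ
      refine rpow_conj_le hL0 hB0 hP1 hx hPκ fun hL1 => ?_
      have hnl : 0 < -Real.log L := by
        have := Real.log_neg hL0 hL1
        linarith
      have hpx : 0 < p x := zero_lt_one.trans_le (h1 x)
      have hinv : 0 < B / -Real.log L + 1 / p x := by positivity
      have hle : 1 / (B / -Real.log L + 1 / p x) ≤ P := by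
        refine le_pMinusOn (hab.mono fun x hx => hx.2) Q ?_
        filter_upwards [ae_restrict_mem Q.measurableSet_toSet] with y hyQ
        have h2 := (hosc x hxQ y hyQ).resolve_right (not_le.2 hL1)
        rw [← le_div_iff₀ hnl] at h2
        rw [one_div_le hinv (zero_lt_one.trans_le (h1 y))]
        linarith
      rw [one_div_le hinv (by linarith)] at hle
      rw [← le_div_iff₀ hnl]
      linarith
    have hmod := setLIntegral_le_one_of_eModular_le (hp1.mono fun x hx => conjExp_eq_ofReal hx)
      (hp1.mono fun x hx => zero_le_one.trans (one_le_conj hx)) _ Q.measurableSet_toSet hl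
    have hSle : S ≤ ENNReal.ofReal E * lam ^ (P / (P - 1)) := by
      calc S ≤ ∫⁻ x in Q.toSet, ENNReal.ofReal (E * L ^ (P / (P - 1))) *
            (ENNReal.ofReal |(w x)⁻¹| / lam) ^ (p x / (p x - 1)) := by
            refine lintegral_mono_ae ?_
            filter_upwards [hpt, ae_restrict_of_ae hp1, ae_restrict_of_ae hw.2] with x hx hpx hwx
            have hq0 : 0 ≤ p x / (p x - 1) := zero_le_one.trans (one_le_conj hpx)
            calc ENNReal.ofReal (σ x)
                = ENNReal.ofReal |(w x)⁻¹| ^ (p x / (p x - 1)) := by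
                  rw [ENNReal.ofReal_rpow_of_nonneg (abs_nonneg _) hq0, hσ x,
                    abs_of_pos (inv_pos.2 hwx), Real.rpow_neg hwx.le, Real.inv_rpow hwx.le]
              _ = lam ^ (p x / (p x - 1)) *
                  (ENNReal.ofReal |(w x)⁻¹| / lam) ^ (p x / (p x - 1)) := by
                  rw [← ENNReal.mul_rpow_of_nonneg _ _ hq0, ENNReal.mul_div_cancel hl0 hltop]
              _ ≤ _ := by
                  refine mul_le_mul_left ?_ _
                  rw [hlamL, ENNReal.ofReal_rpow_of_pos hL0]
                  exact ENNReal.ofReal_le_ofReal hx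
        _ = ENNReal.ofReal (E * L ^ (P / (P - 1))) *
            ∫⁻ x in Q.toSet, (ENNReal.ofReal |(w x)⁻¹| / lam) ^ (p x / (p x - 1)) := by
            have := hw.1
            exact lintegral_const_mul _ (by fun_prop)
        _ ≤ ENNReal.ofReal (E * L ^ (P / (P - 1))) * 1 := mul_le_mul_right hmod _
        _ = ENNReal.ofReal E * lam ^ (P / (P - 1)) := by
            rw [mul_one, ENNReal.ofReal_mul (by positivity), hlamL,
              ENNReal.ofReal_rpow_of_pos hL0]
    have hs0 : 0 ≤ 1 - 1 / P := by
      have : 1 / P ≤ 1 := (div_le_one (by linarith)).2 hP1.le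
      linarith
    calc S ^ (1 - 1 / P) ≤ (ENNReal.ofReal E * lam ^ (P / (P - 1))) ^ (1 - 1 / P) := by gcongr
      _ = ENNReal.ofReal E ^ (1 - 1 / P) * lam := by
          rw [ENNReal.mul_rpow_of_nonneg _ _ hs0, ← ENNReal.rpow_mul]
          have : P / (P - 1) * (1 - 1 / P) = 1 := by
            have : P ≠ 0 := by linarith
            field_simp
          rw [this, ENNReal.rpow_one]
      _ ≤ ENNReal.ofReal E * lam := by
          refine mul_le_mul_left ?_ _
          have : 0 ≤ 1 / P := one_div_nonneg.2 (by linarith)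
          calc ENNReal.ofReal E ^ (1 - 1 / P) ≤ ENNReal.ofReal E ^ (1 : ℝ) :=
                ENNReal.rpow_le_rpow_of_exponent_le (by simpa using hE1) (by linarith)
            _ = _ := ENNReal.rpow_one _
  have hs0 : 0 ≤ 1 - 1 / P := by
    have : 1 / P ≤ 1 := (div_le_one (by linarith)).2 hP1.le
    linarith
  refine ENNReal.div_le_of_le_mul ?_
  calc S = S ^ (1 - 1 / P) * S ^ (1 / P) := by
        rw [← ENNReal.rpow_add_of_nonneg _ _ hs0 (one_div_nonneg.2 (by linarith))]
        simp
    _ ≤ ENNReal.ofReal E * N * S ^ (1 / P) := mul_le_mul_left hpow _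
    _ = _ := by ring

/-- Raising the linear estimate to a bounded power `q`. -/
theorem rpow_le_of_le_ofReal_mul {X S : ℝ≥0∞} {E D q b P : ℝ} (hE : 1 ≤ E) (hED : E ≤ D)
    (hq0 : 0 ≤ q) (hqb : q ≤ b) (h : X ≤ ENNReal.ofReal E * S ^ (1 / P)) :
    X ^ q ≤ ENNReal.ofReal D ^ b * S ^ (q / P) := by
  calc X ^ q ≤ (ENNReal.ofReal E * S ^ (1 / P)) ^ q := by gcongr
    _ = ENNReal.ofReal E ^ q * S ^ (q / P) := by
        rw [ENNReal.mul_rpow_of_nonneg _ _ hq0, ← ENNReal.rpow_mul]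
        congr 2
        ring
    _ ≤ ENNReal.ofReal D ^ b * S ^ (q / P) := by
        refine mul_le_mul_left ?_ _
        refine le_trans (ENNReal.rpow_le_rpow_of_exponent_le (by simpa using hE) hqb) ?_
        exact ENNReal.rpow_le_rpow (ENNReal.ofReal_le_ofReal hED) (by linarith)

/-- the estimate
`(σₗ(Q)/‖wₗ^{-1}χ_Q‖_{pₗ'(·)})^{q(Q)} ≲ σₗ(Q)^{q(Q)/(pₗ)₋(Q)}` for `l = 1,2`. -/
theorem statement13 {n : ℕ} (p₁ p₂ p w₁ w₂ w σ₁ σ₂ : Rn n → ℝ)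
    (hp₁m : Measurable p₁) (hp₂m : Measurable p₂)
    (hp₁1 : ∀ x, 1 ≤ p₁ x) (hp₂1 : ∀ x, 1 ≤ p₂ x)
    (hp₁b : ∃ a b : ℝ, 1 < a ∧ ∀ᵐ x ∂(volume : Measure (Rn n)), a ≤ p₁ x ∧ p₁ x ≤ b)
    (hp₂b : ∃ a b : ℝ, 1 < a ∧ ∀ᵐ x ∂(volume : Measure (Rn n)), a ≤ p₂ x ∧ p₂ x ≤ b)
    (hp₁LH : LH p₁) (hp₂LH : LH p₂)
    (hp : ∀ x, 1 / p x = 1 / p₁ x + 1 / p₂ x)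
    (hw₁ : IsWeight w₁) (hw₂ : IsWeight w₂)
    (hw : ∀ x, w x = w₁ x * w₂ x)
    (hA : ApVec p₁ p₂ p w₁ w₂ w)
    (hσ₁ : ∀ x, σ₁ x = w₁ x ^ (-(p₁ x / (p₁ x - 1))))
    (hσ₂ : ∀ x, σ₂ x = w₂ x ^ (-(p₂ x / (p₂ x - 1)))) :
    ∃ C : ℝ≥0∞, C ≠ ∞ ∧ ∀ Q : Cube n,
      ((∫⁻ y in Q.toSet, ENNReal.ofReal (σ₁ y)) /
          vNorm (conjExp p₁) (Q.toSet.indicator fun x => (w₁ x)⁻¹)) ^ qExp p₁ p₂ Q ≤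
        C * (∫⁻ y in Q.toSet, ENNReal.ofReal (σ₁ y)) ^ (qExp p₁ p₂ Q / pMinusOn p₁ Q) ∧
      ((∫⁻ y in Q.toSet, ENNReal.ofReal (σ₂ y)) /
          vNorm (conjExp p₂) (Q.toSet.indicator fun x => (w₂ x)⁻¹)) ^ qExp p₁ p₂ Q ≤
        C * (∫⁻ y in Q.toSet, ENNReal.ofReal (σ₂ y)) ^ (qExp p₁ p₂ Q / pMinusOn p₂ Q) := by
  obtain ⟨a₁, b₁, ha₁, hab₁⟩ := hp₁b
  obtain ⟨a₂, b₂, ha₂, hab₂⟩ := hp₂b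
  have h₁ : ∀ᵐ x ∂(volume : Measure (Rn n)), 1 < p₁ x := hab₁.mono fun x hx => ha₁.trans_le hx.1
  have h₂ : ∀ᵐ x ∂(volume : Measure (Rn n)), 1 < p₂ x := hab₂.mono fun x hx => ha₂.trans_le hx.1
  have hA' : ApVec p₂ p₁ p w₂ w₁ w := by
    obtain ⟨A, hA0, hA⟩ := hA
    refine ⟨A, hA0, fun Q => ?_⟩
    rw [mul_right_comm]
    exact hA Q
  have hp' : ∀ x, 1 / p x = 1 / p₂ x + 1 / p₁ x := fun x => by rw [hp x, add_comm]
  have hw' : ∀ x, w x = w₂ x * w₁ x := fun x => by rw [hw x, mul_comm]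
  have hH := sq_vol_le_mul_vNorm hp₁m hp₂m h₁ h₂ hp hw₁ hw₂ hw
  obtain ⟨c₁, hc₁0, hc₁1, hc₁⟩ := hA.exists_le_vNorm hp₁m hp₂m h₁ h₂ hp hw₁ hw₂ hw
  obtain ⟨c₂, hc₂0, hc₂1, hc₂⟩ := hA'.exists_le_vNorm hp₂m hp₁m h₂ h₁ hp' hw₂ hw₁ hw'
  obtain ⟨E₁, hE₁, hS₁⟩ := exists_div_vNorm_le hp₁m hp₁1 ha₁ hab₁ hp₁LH hw₁ hσ₁ hc₁0 hc₁1
    (fun Q => (hH Q).2.1) hc₁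
  obtain ⟨E₂, hE₂, hS₂⟩ := exists_div_vNorm_le hp₂m hp₂1 ha₂ hab₂ hp₂LH hw₂ hσ₂ hc₂0 hc₂1
    (fun Q => (hH Q).2.2.1) hc₂
  have hP₁ : ∀ Q : Cube n, 1 ≤ pMinusOn p₁ Q := fun Q =>
    le_pMinusOn (hab₁.mono fun x hx => hx.2) Q (.of_forall hp₁1)
  have hP₂ : ∀ Q : Cube n, 1 ≤ pMinusOn p₂ Q := fun Q =>
    le_pMinusOn (hab₂.mono fun x hx => hx.2) Q (.of_forall hp₂1)
  have hq0 : ∀ Q : Cube n, 0 ≤ qExp p₁ p₂ Q := fun Q => by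
    have := zero_lt_one.trans_le (hP₁ Q)
    have := zero_lt_one.trans_le (hP₂ Q)
    rw [qExp]
    positivity
  have hqb : ∀ Q : Cube n, qExp p₁ p₂ Q ≤ b₁ := fun Q => by
    have h3 := zero_lt_one.trans_le (hP₁ Q)
    have h4 := zero_lt_one.trans_le (hP₂ Q)
    refine le_trans ?_ (pMinusOn_le_of_ae_le hp₁1 (hab₁.mono fun x hx => hx.2) Q)
    rw [qExp, inv_le_comm₀ (by positivity) h3]
    exact le_add_of_nonneg_right (inv_nonneg.2 h4.le)
  have hb₁ : 0 ≤ b₁ := (hq0 ⟨0, 1, one_pos⟩).trans (hqb _)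
  refine ⟨ENNReal.ofReal (max E₁ E₂) ^ b₁,
    ENNReal.rpow_ne_top_of_nonneg hb₁ ENNReal.ofReal_ne_top, fun Q => ⟨?_, ?_⟩⟩
  · exact rpow_le_of_le_ofReal_mul hE₁ (le_max_left _ _) (hq0 Q) (hqb Q) (hS₁ Q)
  · exact rpow_le_of_le_ofReal_mul hE₂ (le_max_right _ _) (hq0 Q) (hqb Q) (hS₂ Q)
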